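/- arXiv:1611.07994 — 5 statements merged into one kernel-verified Lean document; each statement's English description precedes it below -/
import Mathlib

section
/- Let F be a functional on the space C_{b,Lip}(ℝ^d) of bounded Lipschitz functions φ : ℝ^d → ℝ satisfying: (i) monotonicity (φ ≤ ψ pointwise implies F[φ] ≤ F[ψ]); (ii) constant preserving (F[c] = c for every constant function c); (iii) subadditivity (F[φ + ψ] ≤ F[φ] + F[ψ]); (iv) positive homogeneity (F[λ φ] = λ F[φ] for every real λ ≥ 0); and (v) regularity: for every sequence (φ_n) of bounded Lipschitz functions with φ_n(x) decreasing to 0 for every x ∈ ℝ^d, one has F[φ_n] → 0. Then there exists a nonempty family {F_θ}_{θ ∈ Θ} of Borel probability measures on ℝ^d such that F[φ] = sup_{θ ∈ Θ} ∫_{ℝ^d} φ(x) F_θ(dx) for every bounded Lipschitz φ : ℝ^d → ℝ. -/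
open Filter Topology MeasureTheory
open scoped BoundedContinuousFunction CompactlySupported

/-- A real function that is bounded and Lipschitz. -/
def IsBoundedLipschitz {X : Type*} [PseudoMetricSpace X] (φ : X → ℝ) : Prop :=
  (∃ C : ℝ, ∀ x, |φ x| ≤ C) ∧ ∃ K : NNReal, LipschitzWith K φ

/-- A sublinear expectation on bounded Lipschitz functions. -/
structure IsSublinearExpectation {X : Type*} [PseudoMetricSpace X] (F : (X → ℝ) → ℝ) : Prop where
  mono : ∀ φ ψ, IsBoundedLipschitz φ → IsBoundedLipschitz ψ → (∀ x, φ x ≤ ψ x) → F φ ≤ F ψ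
  const : ∀ c : ℝ, F (fun _ => c) = c
  add_le : ∀ φ ψ, IsBoundedLipschitz φ → IsBoundedLipschitz ψ →
    F (fun x => φ x + ψ x) ≤ F φ + F ψ
  const_mul : ∀ c : ℝ, 0 ≤ c → ∀ φ, IsBoundedLipschitz φ → F (fun x => c * φ x) = c * F φ

namespace IsBoundedLipschitz

variable {X : Type*} [PseudoMetricSpace X] {φ ψ : X → ℝ}

theorem const (c : ℝ) : IsBoundedLipschitz fun _ : X => c :=
  ⟨⟨|c|, fun _ => le_rfl⟩, 0, LipschitzWith.const c⟩

theorem add (hφ : IsBoundedLipschitz φ) (hψ : IsBoundedLipschitz ψ) :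
    IsBoundedLipschitz fun x => φ x + ψ x := by
  obtain ⟨⟨C, hC⟩, K, hK⟩ := hφ
  obtain ⟨⟨D, hD⟩, L, hL⟩ := hψ
  exact ⟨⟨C + D, fun x => (abs_add_le _ _).trans (add_le_add (hC x) (hD x))⟩, K + L, hK.add hL⟩

theorem const_mul (hφ : IsBoundedLipschitz φ) (c : ℝ) : IsBoundedLipschitz fun x => c * φ x := by
  obtain ⟨⟨C, hC⟩, K, hK⟩ := hφ
  refine ⟨⟨|c| * C, fun x => ?_⟩, ‖c‖₊ * K, (lipschitzWith_smul c).comp hK⟩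
  rw [abs_mul]
  exact mul_le_mul_of_nonneg_left (hC x) (abs_nonneg c)

/-- A bounded Lipschitz function as a bounded continuous function. -/
noncomputable def toBCF (hφ : IsBoundedLipschitz φ) : X →ᵇ ℝ :=
  BoundedContinuousFunction.ofNormedAddCommGroup φ hφ.2.choose_spec.continuous
    hφ.1.choose hφ.1.choose_spec

@[simp]
theorem toBCF_apply (hφ : IsBoundedLipschitz φ) (x : X) : hφ.toBCF x = φ x := rfl

end IsBoundedLipschitz

/-- The least upper value given to a bounded continuous function by a functional on bounded
Lipschitz functions. -/
noncomputable def upperExtension {X : Type*} [PseudoMetricSpace X] (F : (X → ℝ) → ℝ)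
    (f : X →ᵇ ℝ) : ℝ :=
  sInf {a | ∃ φ, IsBoundedLipschitz φ ∧ (∀ x, f x ≤ φ x) ∧ F φ = a}

theorem le_upperExtension {X : Type*} [PseudoMetricSpace X] {F : (X → ℝ) → ℝ}
    {f : X →ᵇ ℝ} {a : ℝ}
    (h : ∀ φ, IsBoundedLipschitz φ → (∀ x, f x ≤ φ x) → a ≤ F φ) : a ≤ upperExtension F f := by
  refine le_csInf ⟨F fun _ => ‖f‖, _, .const _, fun x => ?_, rfl⟩ ?_
  · exact (le_abs_self _).trans (f.norm_coe_le_norm x)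
  · rintro _ ⟨φ, hφ, hfφ, rfl⟩
    exact h φ hφ hfφ

namespace IsSublinearExpectation

variable {X : Type*} [PseudoMetricSpace X] {F : (X → ℝ) → ℝ}

theorem upperExtension_le (hF : IsSublinearExpectation F) {f : X →ᵇ ℝ} {φ : X → ℝ}
    (hφ : IsBoundedLipschitz φ) (h : ∀ x, f x ≤ φ x) : upperExtension F f ≤ F φ := by
  refine csInf_le ⟨-‖f‖, ?_⟩ ⟨φ, hφ, h, rfl⟩
  rintro _ ⟨ψ, hψ, hfψ, rfl⟩
  rw [← hF.const (-‖f‖)]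
  exact hF.mono _ _ (.const _) hψ fun x =>
    (neg_le_of_abs_le (f.norm_coe_le_norm x)).trans (hfψ x)

theorem upperExtension_toBCF (hF : IsSublinearExpectation F) {φ : X → ℝ}
    (hφ : IsBoundedLipschitz φ) : upperExtension F hφ.toBCF = F φ :=
  (hF.upperExtension_le hφ fun _ => le_rfl).antisymm
    (le_upperExtension fun ψ hψ h => hF.mono φ ψ hφ hψ h)

theorem upperExtension_add_le (hF : IsSublinearExpectation F) (f g : X →ᵇ ℝ) :
    upperExtension F (f + g) ≤ upperExtension F f + upperExtension F g := by
  rw [← sub_le_iff_le_add]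
  refine le_upperExtension fun φ hφ hf => ?_
  rw [sub_le_comm]
  refine le_upperExtension fun ψ hψ hg => ?_
  rw [sub_le_iff_le_add']
  exact (hF.upperExtension_le (hφ.add hψ) fun x => add_le_add (hf x) (hg x)).trans
    (hF.add_le φ ψ hφ hψ)

theorem upperExtension_smul_le (hF : IsSublinearExpectation F) {c : ℝ} (hc : 0 < c)
    (f : X →ᵇ ℝ) : upperExtension F (c • f) ≤ c * upperExtension F f := by
  rw [← div_le_iff₀' hc]
  refine le_upperExtension fun φ hφ hf => ?_
  rw [div_le_iff₀' hc, ← hF.const_mul c hc.le φ hφ]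
  exact hF.upperExtension_le (hφ.const_mul c) fun x => mul_le_mul_of_nonneg_left (hf x) hc.le

theorem upperExtension_smul (hF : IsSublinearExpectation F) {c : ℝ} (hc : 0 < c)
    (f : X →ᵇ ℝ) : upperExtension F (c • f) = c * upperExtension F f := by
  refine (hF.upperExtension_smul_le hc f).antisymm ?_
  have h := hF.upperExtension_smul_le (inv_pos.2 hc) (c • f)
  rwa [inv_smul_smul₀ hc.ne', ← div_eq_inv_mul, le_div_iff₀' hc] at h

end IsSublinearExpectation

/-- A sublinear functional has a linear minorant touching it at any given point. -/
theorem exists_linearMap_le_sublinear_eq {E : Type*} [AddCommGroup E] [Module ℝ E] (N : E → ℝ)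
    (N_hom : ∀ c : ℝ, 0 < c → ∀ x, N (c • x) = c * N x)
    (N_add : ∀ x y, N (x + y) ≤ N x + N y) (x : E) :
    ∃ g : E →ₗ[ℝ] ℝ, g x = N x ∧ ∀ y, g y ≤ N y := by
  have N_zero : N 0 = 0 := by
    have h := N_hom 2 two_pos 0
    rw [smul_zero] at h
    linarith
  have H : ∀ c : ℝ, c • x = 0 → RingHom.id ℝ c • N x = 0 := by
    intro c hc
    rcases smul_eq_zero.1 hc with rfl | rfl <;> simp [N_zero]
  obtain ⟨g, hg, hgN⟩ := exists_extension_of_le_sublinear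
    (LinearPMap.mkSpanSingleton' x (N x) H) N N_hom N_add <| by
      rintro ⟨y, hy⟩
      obtain ⟨c, rfl⟩ := Submodule.mem_span_singleton.1 hy
      rw [LinearPMap.mkSpanSingleton'_apply]
      simp only [RingHom.id_apply, smul_eq_mul]
      rcases lt_trichotomy c 0 with hc | rfl | hc
      · have h := N_add (c • x) ((-c) • x)
        rw [← add_smul, add_neg_cancel, zero_smul, N_zero, N_hom (-c) (neg_pos.2 hc)] at h
        linarith
      · simp [N_zero]
      · exact (N_hom c hc x).ge
  refine ⟨g, ?_, hgN⟩
  exact (hg ⟨x, Submodule.mem_span_singleton_self x⟩).trans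
    (LinearPMap.mkSpanSingleton'_apply_self x (N x) H _)

/-- Any bounded Lipschitz function admits a normalized positive linear functional that is dominated
by the sublinear expectation and agrees with it there. -/
theorem IsSublinearExpectation.exists_linearMap_eq {X : Type*} [PseudoMetricSpace X]
    {F : (X → ℝ) → ℝ} (hF : IsSublinearExpectation F) {φ : X → ℝ} (hφ : IsBoundedLipschitz φ) :
    ∃ Λ : (X →ᵇ ℝ) →ₗ[ℝ] ℝ, Λ hφ.toBCF = F φ ∧
      (∀ ψ (hψ : IsBoundedLipschitz ψ), Λ hψ.toBCF ≤ F ψ) ∧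
      (∀ f, (∀ x, 0 ≤ f x) → 0 ≤ Λ f) ∧ Λ (BoundedContinuousFunction.const X 1) = 1 := by
  obtain ⟨Λ, hΛφ, hΛ⟩ := exists_linearMap_le_sublinear_eq (upperExtension F)
    (fun c hc f => by rw [hF.upperExtension_smul hc f]) hF.upperExtension_add_le hφ.toBCF
  have hΛ_le : ∀ (f : X →ᵇ ℝ) (c : ℝ), (∀ x, f x ≤ c) → Λ f ≤ c := fun f c h =>
    (hΛ f).trans ((hF.upperExtension_le (.const c) h).trans (hF.const c).le)
  refine ⟨Λ, hΛφ.trans (hF.upperExtension_toBCF hφ),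
    fun ψ hψ => (hΛ _).trans (hF.upperExtension_toBCF hψ).le, fun f hf => ?_,
    (hΛ_le _ 1 fun _ => le_rfl).antisymm ?_⟩
  · have := hΛ_le (-f) 0 fun x => neg_nonpos.2 (hf x)
    rwa [map_neg, neg_nonpos] at this
  · have := hΛ_le (-BoundedContinuousFunction.const X 1) (-1) fun _ => le_rfl
    rwa [map_neg, neg_le_neg_iff] at this

section Cutoff

variable {E : Type*} [NormedAddCommGroup E]

/-- A Lipschitz cutoff function equal to `1` on the closed ball of radius `n` and vanishing outside
the closed ball of radius `n + 1`. -/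
noncomputable def radialCutoff (n : ℕ) (x : E) : ℝ :=
  max 0 (min 1 (n + 1 - ‖x‖))

theorem radialCutoff_nonneg (n : ℕ) (x : E) : 0 ≤ radialCutoff n x := le_max_left _ _

theorem radialCutoff_le_one (n : ℕ) (x : E) : radialCutoff n x ≤ 1 :=
  max_le zero_le_one (min_le_left _ _)

theorem abs_radialCutoff_le_one (n : ℕ) (x : E) : |radialCutoff n x| ≤ 1 := by
  rw [abs_of_nonneg (radialCutoff_nonneg n x)]
  exact radialCutoff_le_one n x

theorem radialCutoff_eq_one {n : ℕ} {x : E} (h : ‖x‖ ≤ n) : radialCutoff n x = 1 := by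
  rw [radialCutoff, min_eq_left (by linarith), max_eq_right zero_le_one]

theorem radialCutoff_eq_zero {n : ℕ} {x : E} (h : n + 1 ≤ ‖x‖) : radialCutoff n x = 0 :=
  max_eq_left ((min_le_right _ _).trans (by linarith))

theorem radialCutoff_le_succ (n : ℕ) (x : E) : radialCutoff n x ≤ radialCutoff (n + 1) x := by
  unfold radialCutoff
  push_cast
  gcongr
  linarith

theorem tendsto_radialCutoff (x : E) : Tendsto (fun n => radialCutoff n x) atTop (𝓝 1) := by
  obtain ⟨N, hN⟩ := exists_nat_ge ‖x‖
  refine tendsto_const_nhds.congr' ?_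
  filter_upwards [eventually_ge_atTop N] with n hn
  exact (radialCutoff_eq_one (hN.trans (by exact_mod_cast hn))).symm

theorem isBoundedLipschitz_radialCutoff (n : ℕ) :
    IsBoundedLipschitz (radialCutoff n : E → ℝ) := by
  refine ⟨⟨1, abs_radialCutoff_le_one n⟩, 1, ?_⟩
  have h : LipschitzWith 1 fun x : E => (n : ℝ) + 1 - ‖x‖ := by
    simpa using (LipschitzWith.const ((n : ℝ) + 1)).sub lipschitzWith_one_norm
  exact (h.const_min 1).const_max 0

theorem isBoundedLipschitz_one_sub_radialCutoff (n : ℕ) :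
    IsBoundedLipschitz fun x : E => 1 - radialCutoff n x := by
  simpa [sub_eq_add_neg] using
    (IsBoundedLipschitz.const 1).add ((isBoundedLipschitz_radialCutoff (E := E) n).const_mul (-1))

theorem hasCompactSupport_radialCutoff [ProperSpace E] (n : ℕ) :
    HasCompactSupport (radialCutoff n : E → ℝ) := by
  refine HasCompactSupport.intro (isCompact_closedBall (0 : E) (n + 1)) fun x hx => ?_
  rw [mem_closedBall_zero_iff, not_le] at hx
  exact radialCutoff_eq_zero hx.le

/-- The product of a bounded continuous function with a cutoff, as a compactly supported
function. -/
noncomputable def mulRadialCutoff [ProperSpace E] (f : E →ᵇ ℝ) (n : ℕ) : C_c(E, ℝ) where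
  toFun x := f x * radialCutoff n x
  continuous_toFun := f.continuous.mul (isBoundedLipschitz_radialCutoff n).2.choose_spec.continuous
  hasCompactSupport' := (hasCompactSupport_radialCutoff n).mul_left

@[simp]
theorem mulRadialCutoff_apply [ProperSpace E] (f : E →ᵇ ℝ) (n : ℕ) (x : E) :
    mulRadialCutoff f n x = f x * radialCutoff n x := rfl

/-- A normalized positive linear functional on bounded continuous functions which does not charge
infinity is the integral against a probability measure. -/
theorem exists_isProbabilityMeasure_integral_eq [ProperSpace E] [MeasurableSpace E] [BorelSpace E]
    (Λ : (E →ᵇ ℝ) →ₗ[ℝ] ℝ) (hΛ : ∀ f, (∀ x, 0 ≤ f x) → 0 ≤ Λ f)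
    (hone : Λ (BoundedContinuousFunction.const E 1) = 1)
    (htight : Tendsto (fun n => Λ (isBoundedLipschitz_one_sub_radialCutoff (E := E) n).toBCF)
      atTop (𝓝 0)) :
    ∃ μ : Measure E, IsProbabilityMeasure μ ∧ ∀ f : E →ᵇ ℝ, ∫ x, f x ∂μ = Λ f := by
  have hΛ_mono : ∀ f g : E →ᵇ ℝ, (∀ x, f x ≤ g x) → Λ f ≤ Λ g := fun f g h => by
    have := hΛ (g - f) fun x => sub_nonneg.2 (h x)
    rwa [map_sub, sub_nonneg] at this
  let L : C_c(E, ℝ) →ₚ[ℝ] ℝ := PositiveLinearMap.mk₀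
    { toFun := fun f => Λ f.toBoundedContinuousFunction
      map_add' := fun f g => by
        rw [← map_add]
        rfl
      map_smul' := fun c f => by
        rw [RingHom.id_apply, ← map_smul]
        rfl }
    fun f hf => hΛ _ fun x => hf x
  have hL : ∀ f, L f = Λ f.toBoundedContinuousFunction := fun _ => rfl
  let μ := RealRMK.rieszMeasure L
  have hball : ∀ n : ℕ, μ (Metric.closedBall 0 n) ≤ 1 := fun n => by
    have h := RealRMK.rieszMeasure_le_of_eq_one L
      (f := mulRadialCutoff (BoundedContinuousFunction.const E 1) n)
      (fun x => by simpa using radialCutoff_nonneg n x)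
      (isCompact_closedBall (0 : E) n)
      (fun x hx => by simpa using radialCutoff_eq_one (mem_closedBall_zero_iff.1 hx))
    refine h.trans ?_
    rw [hL, ENNReal.ofReal_le_one]
    refine (hΛ_mono _ (BoundedContinuousFunction.const E 1) fun x => ?_).trans hone.le
    simpa using radialCutoff_le_one n x
  have hfin : μ Set.univ ≤ 1 := by
    rw [← Metric.iUnion_closedBall_nat (0 : E)]
    exact le_of_tendsto' (tendsto_measure_iUnion_atTop fun m n hmn =>
      Metric.closedBall_subset_closedBall (by exact_mod_cast hmn)) hball
  have : IsFiniteMeasure μ := ⟨hfin.trans_lt ENNReal.one_lt_top⟩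
  have hint : ∀ f : E →ᵇ ℝ, ∫ x, f x ∂μ = Λ f := by
    intro f
    have h_integral : Tendsto (fun n => ∫ x, mulRadialCutoff f n x ∂μ) atTop
        (𝓝 (∫ x, f x ∂μ)) := by
      refine tendsto_integral_of_dominated_convergence (fun _ => ‖f‖)
        (fun n => (mulRadialCutoff f n).continuous.aestronglyMeasurable)
        (integrable_const _) (fun n => ae_of_all _ fun x => ?_) (ae_of_all _ fun x => ?_)
      · rw [mulRadialCutoff_apply, norm_mul]
        exact (mul_le_of_le_one_right (norm_nonneg _) (abs_radialCutoff_le_one n x)).trans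
          (f.norm_coe_le_norm x)
      · simpa using (tendsto_radialCutoff x).const_mul (f x)
    have h_functional : Tendsto (fun n => Λ (mulRadialCutoff f n).toBoundedContinuousFunction)
        atTop (𝓝 (Λ f)) := by
      rw [tendsto_iff_norm_sub_tendsto_zero]
      refine squeeze_zero (fun _ => norm_nonneg _) (fun n => ?_)
        (by simpa using htight.const_mul ‖f‖)
      have hbound : ∀ x, |f x * (1 - radialCutoff n x)| ≤ ‖f‖ * (1 - radialCutoff n x) := by
        intro x
        have h0 := sub_nonneg.2 (radialCutoff_le_one n x)
        rw [abs_mul, abs_of_nonneg h0]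
        exact mul_le_mul_of_nonneg_right (f.norm_coe_le_norm x) h0
      rw [← map_sub, Real.norm_eq_abs, abs_le, ← smul_eq_mul, ← map_smul, ← map_neg]
      constructor
      · refine hΛ_mono _ _ fun x => ?_
        have := (abs_le.1 (hbound x)).2
        simp only [BoundedContinuousFunction.coe_neg, BoundedContinuousFunction.coe_smul,
          BoundedContinuousFunction.coe_sub, Pi.neg_apply, Pi.sub_apply, smul_eq_mul,
          IsBoundedLipschitz.toBCF_apply,
          CompactlySupportedContinuousMap.toBoundedContinuousFunction_apply,
          mulRadialCutoff_apply]
        linarith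
      · refine hΛ_mono _ _ fun x => ?_
        have := (abs_le.1 (hbound x)).1
        simp only [BoundedContinuousFunction.coe_smul,
          BoundedContinuousFunction.coe_sub, Pi.sub_apply, smul_eq_mul,
          IsBoundedLipschitz.toBCF_apply,
          CompactlySupportedContinuousMap.toBoundedContinuousFunction_apply,
          mulRadialCutoff_apply]
        linarith
    refine tendsto_nhds_unique h_integral (h_functional.congr fun n => ?_)
    rw [RealRMK.integral_rieszMeasure, hL]
  refine ⟨μ, ⟨?_⟩, hint⟩
  have h := hint (BoundedContinuousFunction.const E 1)
  rw [hone] at h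
  simp only [BoundedContinuousFunction.const_apply, integral_const, smul_eq_mul, mul_one] at h
  rwa [← ENNReal.toReal_eq_one_iff]

/-- A sublinear expectation continuous along the cutoffs is attained at every bounded Lipschitz
function by the integral against a dominated probability measure. -/
theorem IsSublinearExpectation.exists_measure_integral_eq [ProperSpace E] [MeasurableSpace E]
    [BorelSpace E] {F : (E → ℝ) → ℝ} (hF : IsSublinearExpectation F)
    (hcut : Tendsto (fun n => F fun x => 1 - radialCutoff n x) atTop (𝓝 0))
    {φ : E → ℝ} (hφ : IsBoundedLipschitz φ) :
    ∃ μ : Measure E, IsProbabilityMeasure μ ∧ ∫ x, φ x ∂μ = F φ ∧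
      ∀ ψ, IsBoundedLipschitz ψ → ∫ x, ψ x ∂μ ≤ F ψ := by
  obtain ⟨Λ, hΛφ, hΛF, hΛ_nonneg, hone⟩ := hF.exists_linearMap_eq hφ
  obtain ⟨μ, hμ, hμΛ⟩ := exists_isProbabilityMeasure_integral_eq Λ hΛ_nonneg hone <|
    squeeze_zero (fun n => hΛ_nonneg _ fun x => sub_nonneg.2 (radialCutoff_le_one n x))
      (fun n => hΛF _ (isBoundedLipschitz_one_sub_radialCutoff n)) hcut
  refine ⟨μ, hμ, ?_, fun ψ hψ => (hμΛ hψ.toBCF).trans_le (hΛF ψ hψ)⟩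
  exact (hμΛ hφ.toBCF).trans hΛφ

end Cutoff

/-- **Representation of a sublinear distribution on ℝ^d.**
A regular sublinear expectation on the bounded Lipschitz test functions on
`ℝ^d` is the upper envelope (supremum) of a nonempty family of Borel
probability measures on `ℝ^d`. -/
theorem representation_of_sublinear_distribution
    {d : ℕ} (F : (EuclideanSpace ℝ (Fin d) → ℝ) → ℝ)
    (hmono : ∀ φ ψ : EuclideanSpace ℝ (Fin d) → ℝ,
      (∃ C : ℝ, ∀ x, |φ x| ≤ C) → (∃ K : NNReal, LipschitzWith K φ) →
      (∃ C : ℝ, ∀ x, |ψ x| ≤ C) → (∃ K : NNReal, LipschitzWith K ψ) →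
      (∀ x, φ x ≤ ψ x) → F φ ≤ F ψ)
    (hconst : ∀ c : ℝ, F (fun _ => c) = c)
    (hsub : ∀ φ ψ : EuclideanSpace ℝ (Fin d) → ℝ,
      (∃ C : ℝ, ∀ x, |φ x| ≤ C) → (∃ K : NNReal, LipschitzWith K φ) →
      (∃ C : ℝ, ∀ x, |ψ x| ≤ C) → (∃ K : NNReal, LipschitzWith K ψ) →
      F (fun x => φ x + ψ x) ≤ F φ + F ψ)
    (hpos : ∀ l : ℝ, 0 ≤ l → ∀ φ : EuclideanSpace ℝ (Fin d) → ℝ,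
      (∃ C : ℝ, ∀ x, |φ x| ≤ C) → (∃ K : NNReal, LipschitzWith K φ) →
      F (fun x => l * φ x) = l * F φ)
    (hreg : ∀ φs : ℕ → EuclideanSpace ℝ (Fin d) → ℝ,
      (∀ n, ∃ C : ℝ, ∀ x, |φs n x| ≤ C) → (∀ n, ∃ K : NNReal, LipschitzWith K (φs n)) →
      (∀ x, ∀ n, φs (n + 1) x ≤ φs n x) →
      (∀ x, Filter.Tendsto (fun n => φs n x) Filter.atTop (nhds 0)) →
      Filter.Tendsto (fun n => F (φs n)) Filter.atTop (nhds 0)) :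
    ∃ (Θ : Type) (_ : Nonempty Θ) (P : Θ → MeasureTheory.Measure (EuclideanSpace ℝ (Fin d))),
      (∀ θ, MeasureTheory.IsProbabilityMeasure (P θ)) ∧
      ∀ φ : EuclideanSpace ℝ (Fin d) → ℝ,
        (∃ C : ℝ, ∀ x, |φ x| ≤ C) → (∃ K : NNReal, LipschitzWith K φ) →
        IsLUB (Set.range fun θ => ∫ x, φ x ∂(P θ)) (F φ) := by
  have hF : IsSublinearExpectation F :=
    { mono := fun φ ψ hφ hψ => hmono φ ψ hφ.1 hφ.2 hψ.1 hψ.2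
      const := hconst
      add_le := fun φ ψ hφ hψ => hsub φ ψ hφ.1 hφ.2 hψ.1 hψ.2
      const_mul := fun c hc φ hφ => hpos c hc φ hφ.1 hφ.2 }
  have hcut := hreg (fun n x => 1 - radialCutoff n x)
    (fun n => (isBoundedLipschitz_one_sub_radialCutoff n).1)
    (fun n => (isBoundedLipschitz_one_sub_radialCutoff n).2)
    (fun x n => sub_le_sub_left (radialCutoff_le_succ n x) 1)
    (fun x => by simpa using (tendsto_radialCutoff x).const_sub 1)
  refine ⟨{μ : Measure (EuclideanSpace ℝ (Fin d)) // IsProbabilityMeasure μ ∧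
    ∀ ψ, IsBoundedLipschitz ψ → ∫ x, ψ x ∂μ ≤ F ψ}, ?_, Subtype.val, fun θ => θ.2.1, ?_⟩
  · obtain ⟨μ, hμ, -, hle⟩ := hF.exists_measure_integral_eq hcut (.const 0)
    exact ⟨μ, hμ, hle⟩
  · intro φ hb hL
    obtain ⟨μ, hμ, heq, hle⟩ := hF.exists_measure_integral_eq hcut ⟨hb, hL⟩
    refine IsGreatest.isLUB ⟨⟨⟨μ, hμ, hle⟩, heq⟩, ?_⟩
    rintro _ ⟨θ, rfl⟩
    exact θ.2.2 φ ⟨hb, hL⟩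
end

section
/- Let Ω be a nonempty type and let E : (Ω → ℝ) → ℝ be a functional satisfying monotonicity (X ≤ Y pointwise implies E[X] ≤ E[Y]), subadditivity (E[X + Y] ≤ E[X] + E[Y]), and positive homogeneity (E[λX] = λE[X] for real λ ≥ 0). Let Y : Ω → ℝ. Then the following two conditions are equivalent: (1) lim_{λ→+∞} E[ω ↦ (|Y(ω)| − λ)⁺] = 0; (2) lim_{n→∞} E[ω ↦ |Y(ω)|·1_{|Y(ω)| > n}] = 0, where 1_{|Y(ω)| > n} denotes the indicator of the event {ω : |Y(ω)| > n}. -/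
/-- **Equivalence of the two uniform integrability conditions** under a
monotone, subadditive, positively homogeneous functional `E`:
`lim_{λ→∞} E[(|Y| − λ)⁺] = 0` iff `lim_{n→∞} E[|Y|·1_{|Y|>n}] = 0`. -/
theorem uniform_integrability_equiv
    {Ω : Type*} [Nonempty Ω] (E : (Ω → ℝ) → ℝ)
    (hmono : ∀ X Y : Ω → ℝ, (∀ ω, X ω ≤ Y ω) → E X ≤ E Y)
    (hsub : ∀ X Y : Ω → ℝ, E (fun ω => X ω + Y ω) ≤ E X + E Y)
    (hpos : ∀ l : ℝ, 0 ≤ l → ∀ X : Ω → ℝ, E (fun ω => l * X ω) = l * E X)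
    (Y : Ω → ℝ) :
    Filter.Tendsto (fun l : ℝ => E (fun ω => max (|Y ω| - l) 0))
        Filter.atTop (nhds 0) ↔
      Filter.Tendsto (fun n : ℕ => E (fun ω => if (n : ℝ) < |Y ω| then |Y ω| else 0))
        Filter.atTop (nhds 0) := by
  have E_nonneg : ∀ X : Ω → ℝ, (∀ ω, 0 ≤ X ω) → 0 ≤ E X := by
    intro X hX
    have h := hpos 0 le_rfl X
    simp only [zero_mul] at h
    exact h.symm.le.trans (hmono _ _ hX)
  constructor
  · intro h
    have hlim : Filter.Tendsto
        (fun n : ℕ => 2 * E (fun ω => max (|Y ω| - (n : ℝ) / 2) 0)) Filter.atTop (nhds 0) := by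
      have hn : Filter.Tendsto (fun n : ℕ => (n : ℝ) / 2) Filter.atTop Filter.atTop :=
        tendsto_natCast_atTop_atTop.atTop_div_const two_pos
      simpa using (h.comp hn).const_mul 2
    refine squeeze_zero (fun n => E_nonneg _ fun ω => ?_) (fun n => ?_) hlim
    · split_ifs <;> positivity
    · rw [← hpos 2 zero_le_two]
      refine hmono _ _ fun ω => ?_
      split_ifs with hY
      · linarith [le_max_left (|Y ω| - (n : ℝ) / 2) 0]
      · positivity
  · intro h
    refine squeeze_zero' (.of_forall fun l => E_nonneg _ fun ω => le_max_right _ _) ?_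
      (h.comp (tendsto_nat_floor_atTop (α := ℝ)))
    filter_upwards [Filter.eventually_ge_atTop (0 : ℝ)] with l hl
    refine hmono _ _ fun ω => ?_
    have hfloor := Nat.floor_le hl
    split_ifs with hY
    · exact max_le (by linarith) (abs_nonneg _)
    · exact max_le (by linarith) le_rfl
end

section
/- Let f : ℝ^n → ℝ be continuous and suppose that for all real numbers a ≤ b one has sup_{x ∈ [a,b]^n} f(x) = b (f is an unbiased estimator of the upper mean of the maximal distribution M_{[a,b]} for every a ≤ b). Then f(x_1, …, x_n) ≤ max{x_1, …, x_n} for all (x_1, …, x_n) ∈ ℝ^n. Moreover the function (x_1, …, x_n) ↦ max{x_1, …, x_n} itself satisfies sup_{x ∈ [a,b]^n} max{x_1,…,x_n} = b for all a ≤ b. Hence the maximum statistic max{X_1, …, X_n} is the largest unbiased estimator of the upper mean μ̄ of a maximal distribution. -/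
/-- **The maximum statistic is the largest unbiased estimator of the upper
mean.** If a continuous `f : ℝ^{n+1} → ℝ` satisfies
`sup_{x ∈ [a,b]^{n+1}} f(x) = b` for all `a ≤ b` (unbiasedness for the upper
mean of `M_[a,b]` for every `a ≤ b`), then `f(x) ≤ max{x_1,…,x_{n+1}}`
everywhere; moreover the maximum statistic itself satisfies the unbiasedness
condition. -/
theorem max_is_largest_unbiased_estimator_of_upper_mean
    {n : ℕ} (f : (Fin (n + 1) → ℝ) → ℝ) (hf : Continuous f)
    (hunbiased : ∀ a b : ℝ, a ≤ b →
      sSup (f '' Set.Icc (fun _ : Fin (n + 1) => a) (fun _ : Fin (n + 1) => b)) = b) :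
    (∀ x : Fin (n + 1) → ℝ, f x ≤ Finset.univ.sup' Finset.univ_nonempty x) ∧
    (∀ a b : ℝ, a ≤ b →
      sSup ((fun x : Fin (n + 1) → ℝ => Finset.univ.sup' Finset.univ_nonempty x) ''
        Set.Icc (fun _ : Fin (n + 1) => a) (fun _ : Fin (n + 1) => b)) = b) := by
  refine ⟨fun x => ?_, fun a b hab => IsGreatest.csSup_eq ⟨?_, ?_⟩⟩
  · have hmin : ∀ i, Finset.univ.inf' Finset.univ_nonempty x ≤ x i :=
      fun i => Finset.inf'_le x (Finset.mem_univ i)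
    have hmax : ∀ i, x i ≤ Finset.univ.sup' Finset.univ_nonempty x :=
      fun i => Finset.le_sup' x (Finset.mem_univ i)
    exact (le_csSup (isCompact_Icc.image hf).bddAbove
      (Set.mem_image_of_mem f ⟨hmin, hmax⟩)).trans_eq
      (hunbiased _ _ ((hmin 0).trans (hmax 0)))
  · exact ⟨fun _ => b, ⟨fun _ => hab, le_rfl⟩, Finset.sup'_const _ b⟩
  · rintro _ ⟨x, hx, rfl⟩
    exact Finset.sup'_le _ _ fun i _ => hx.2 i
end

section
/- Let f : ℝ^n → ℝ be continuous and suppose that for all real numbers a ≤ b one has inf_{x ∈ [a,b]^n} f(x) = a (f is an unbiased estimator of the lower mean of the maximal distribution M_{[a,b]} for every a ≤ b). Then f(x_1, …, x_n) ≥ min{x_1, …, x_n} for all (x_1, …, x_n) ∈ ℝ^n. Moreover the function (x_1, …, x_n) ↦ min{x_1, …, x_n} itself satisfies inf_{x ∈ [a,b]^n} min{x_1,…,x_n} = a for all a ≤ b. Hence the minimum statistic min{X_1, …, X_n} is the smallest unbiased estimator of the lower mean μ̲ of a maximal distribution. -/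
/-- **The minimum statistic is the smallest unbiased estimator of the lower
mean.** If a continuous `f : ℝ^{n+1} → ℝ` satisfies
`inf_{x ∈ [a,b]^{n+1}} f(x) = a` for all `a ≤ b` (unbiasedness for the lower
mean of `M_[a,b]` for every `a ≤ b`), then `f(x) ≥ min{x_1,…,x_{n+1}}`
everywhere; moreover the minimum statistic itself satisfies the unbiasedness
condition. -/
theorem min_is_smallest_unbiased_estimator_of_lower_mean
    {n : ℕ} (f : (Fin (n + 1) → ℝ) → ℝ) (hf : Continuous f)
    (hunbiased : ∀ a b : ℝ, a ≤ b →
      sInf (f '' Set.Icc (fun _ : Fin (n + 1) => a) (fun _ : Fin (n + 1) => b)) = a) :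
    (∀ x : Fin (n + 1) → ℝ, Finset.univ.inf' Finset.univ_nonempty x ≤ f x) ∧
    (∀ a b : ℝ, a ≤ b →
      sInf ((fun x : Fin (n + 1) → ℝ => Finset.univ.inf' Finset.univ_nonempty x) ''
        Set.Icc (fun _ : Fin (n + 1) => a) (fun _ : Fin (n + 1) => b)) = a) := by
  constructor
  · intro x
    set a := Finset.univ.inf' Finset.univ_nonempty x
    set b := Finset.univ.sup' Finset.univ_nonempty x
    have hax : ∀ i, a ≤ x i := fun i => Finset.inf'_le x (Finset.mem_univ i)
    have hxb : ∀ i, x i ≤ b := fun i => Finset.le_sup' x (Finset.mem_univ i)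
    rw [← hunbiased a b ((hax 0).trans (hxb 0))]
    exact csInf_le (isCompact_Icc.bddBelow_image hf.continuousOn) ⟨x, ⟨hax, hxb⟩, rfl⟩
  · intro a b hab
    refine IsLeast.csInf_eq ⟨⟨fun _ => a, ⟨le_rfl, fun _ => hab⟩, ?_⟩, ?_⟩
    · exact Finset.inf'_const _ a
    · rintro _ ⟨x, hx, rfl⟩
      exact Finset.le_inf' _ _ fun i _ => hx.1 i
end

section
/- Let a ≤ b be real numbers, let f : ℝ^n → ℝ be continuous, and let φ : ℝ → ℝ be continuous. Set M := sup_{x ∈ [a,b]^n} f(x) and m := inf_{x ∈ [a,b]^n} f(x). Then sup_{x ∈ [a,b]^n} φ(f(x)) = sup_{y ∈ [m, M]} φ(y). Consequently, for an i.i.d. M_{[a,b]} sample X_1, …, X_n under a sublinear expectation, the statistic f(X_1, …, X_n) is maximally distributed M_{[m, M]}. -/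
/-- A continuous real function maps a nonempty closed box onto the interval between its infimum
and its supremum over the box. -/
theorem Continuous.image_pi_Icc_eq_Icc {ι : Type*} {f : (ι → ℝ) → ℝ} (hf : Continuous f)
    {u v : ι → ℝ} (huv : u ≤ v) :
    f '' Set.Icc u v = Set.Icc (sInf (f '' Set.Icc u v)) (sSup (f '' Set.Icc u v)) :=
  eq_Icc_of_connected_compact
    (((convex_Icc u v).isConnected (Set.nonempty_Icc.2 huv)).image f hf.continuousOn)
    (isCompact_Icc.image hf)

/-- For continuous `f : ℝ^n → ℝ` and `φ : ℝ → ℝ`, with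
`M := sup_{x ∈ [a,b]^n} f(x)` and `m := inf_{x ∈ [a,b]^n} f(x)`, one has
`sup_{x ∈ [a,b]^n} φ(f(x)) = sup_{y ∈ [m,M]} φ(y)`.
Consequently, for an i.i.d. `M_[a,b]` sample `X_1, …, X_n` under a sublinear
expectation (whose expectation of every continuous statistic is the supremum
over the box `[a,b]^n`), the statistic `f(X_1,…,X_n)` is maximally
distributed `M_[m,M]`. -/
theorem continuous_statistic_of_maximal_sample_is_maximally_distributed
    {n : ℕ} (a b : ℝ) (hab : a ≤ b)
    (f : (Fin n → ℝ) → ℝ) (hf : Continuous f)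
    (φ : ℝ → ℝ) (hφ : Continuous φ) :
    sSup ((fun x => φ (f x)) '' Set.Icc (fun _ : Fin n => a) (fun _ : Fin n => b)) =
      sSup (φ '' Set.Icc
        (sInf (f '' Set.Icc (fun _ : Fin n => a) (fun _ : Fin n => b)))
        (sSup (f '' Set.Icc (fun _ : Fin n => a) (fun _ : Fin n => b)))) ∧
    ∀ (Ω : Type) (E : (Ω → ℝ) → ℝ) (X : Fin n → Ω → ℝ),
      (∀ g : (Fin n → ℝ) → ℝ, Continuous g →
        E (fun ω => g (fun i => X i ω)) =
          sSup (g '' Set.Icc (fun _ : Fin n => a) (fun _ : Fin n => b))) →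
      E (fun ω => φ (f (fun i => X i ω))) =
        sSup (φ '' Set.Icc
          (sInf (f '' Set.Icc (fun _ : Fin n => a) (fun _ : Fin n => b)))
          (sSup (f '' Set.Icc (fun _ : Fin n => a) (fun _ : Fin n => b)))) := by
  have key : sSup ((fun x => φ (f x)) '' Set.Icc (fun _ : Fin n => a) (fun _ : Fin n => b)) =
      sSup (φ '' Set.Icc
        (sInf (f '' Set.Icc (fun _ : Fin n => a) (fun _ : Fin n => b)))
        (sSup (f '' Set.Icc (fun _ : Fin n => a) (fun _ : Fin n => b)))) := by
    rw [← hf.image_pi_Icc_eq_Icc (fun _ => hab), Set.image_image]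
  exact ⟨key, fun Ω E X hE => (hE (fun x => φ (f x)) (hφ.comp hf)).trans key⟩
end
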